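/- Let A > 0 be real and let u : ℝ → ℝ be twice continuously differentiable on [0, T] with u''(t) + A·u(t) = 0 for all t ∈ [0, T]. Let t_0 = 0 < t_1 < … < t_N = T with N ≥ 2, τ_n = t_{n+1} − t_n, and let (u^n), (v^n) be real sequences satisfying the scalar Crank–Nicolson scheme with f^n = 0 and exact initial data u⁰ = u(0), v⁰ = u'(0). Then max_{0 ≤ n ≤ N} ( |v^n − u'(t_n)|² + A·|u^n − u(t_n)|² )^{1/2} ≤ 2[ τ_0·( (5/12)τ_0² + (1/2)τ_1τ_0 )·( A(∂²₁v)² + A²(∂²₁u)² )^{1/2} + Σ_{k=1}^{N−1} τ_k·( τ_k²/12 + τ_{k−1}τ_k/8 )·( A(∂²_k v)² + A²(∂²_k u)² )^{1/2} ]. -/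

import Mathlib

/-- Second divided-difference operator `∂²_k w` for a scalar sequence with variable
time steps `τ`. -/
noncomputable def secondDiff (τ : ℕ → ℝ) (w : ℕ → ℝ) (k : ℕ) : ℝ :=
  ((w (k + 1) - w k) / τ k - (w k - w (k - 1)) / τ (k - 1)) / ((τ k + τ (k - 1)) / 2)

open Complex in
theorem norm_one_add_ofReal_mul_I (a : ℝ) : ‖(1 + a * I : ℂ)‖ = √(1 + a ^ 2) := by
  simpa using norm_add_mul_I 1 a

open Complex in
theorem norm_one_sub_ofReal_mul_I (a : ℝ) : ‖(1 - a * I : ℂ)‖ = √(1 + a ^ 2) := by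
  simpa [sub_eq_add_neg] using norm_add_mul_I 1 (-a)

theorem hasDerivAt_sin_sub_mul_cos (x : ℝ) :
    HasDerivAt (fun y => Real.sin y - y * Real.cos y) (x * Real.sin x) x := by
  refine ((Real.hasDerivAt_sin x).sub
    ((hasDerivAt_id x).mul (Real.hasDerivAt_cos x))).congr_deriv ?_
  simp only [id_eq]
  ring

theorem abs_sin_sub_mul_cos_le_of_deriv {B B' : ℝ → ℝ} (hB0 : B 0 = 0)
    (hB : ∀ x, HasDerivAt B (B' x) x) (hB' : ∀ x, 0 ≤ x → |x * Real.sin x| ≤ B' x)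
    {a : ℝ} (ha : 0 ≤ a) : |Real.sin a - a * Real.cos a| ≤ B a :=
  image_norm_le_of_norm_deriv_right_le_deriv_boundary
    (f := fun y => Real.sin y - y * Real.cos y) (by fun_prop)
    (fun x _ => (hasDerivAt_sin_sub_mul_cos x).hasDerivWithinAt) (by simp [hB0]) hB
    (fun x hx => hB' x hx.1) (Set.right_mem_Icc.2 ha)

theorem abs_sin_sub_mul_cos_le_cube {a : ℝ} (ha : 0 ≤ a) :
    |Real.sin a - a * Real.cos a| ≤ a ^ 3 / 3 := by
  refine abs_sin_sub_mul_cos_le_of_deriv (B := fun x => x ^ 3 / 3) (B' := fun x => x ^ 2)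
    (by simp) (fun x => ?_) (fun x hx => ?_) ha
  · exact ((hasDerivAt_pow 3 x).div_const 3).congr_deriv (by norm_num)
  · rw [abs_mul, abs_of_nonneg hx, sq]
    gcongr
    simpa [abs_of_nonneg hx] using Real.abs_sin_le_abs (x := x)

theorem abs_sin_sub_mul_cos_le_sq {a : ℝ} (ha : 0 ≤ a) :
    |Real.sin a - a * Real.cos a| ≤ a ^ 2 / 2 := by
  refine abs_sin_sub_mul_cos_le_of_deriv (B := fun x => x ^ 2 / 2) (B' := fun x => x)
    (by simp) (fun x => ?_) (fun x hx => ?_) ha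
  · exact ((hasDerivAt_pow 2 x).div_const 2).congr_deriv (by norm_num)
  · rw [abs_mul, abs_of_nonneg hx]
    exact mul_le_of_le_one_right hx (Real.abs_sin_le_one x)

open Complex in
theorem norm_eq_of_cayley {a : ℝ} {Y Z : ℂ} (h : (1 - a * I) * Z = (1 + a * I) * Y) :
    ‖Z‖ = ‖Y‖ := by
  have h' := congrArg norm h
  rw [norm_mul, norm_mul, norm_one_add_ofReal_mul_I, norm_one_sub_ofReal_mul_I] at h'
  exact mul_left_cancel₀ (by positivity) h'

open Complex in
/-- Defect of one Crank–Nicolson step, relative to the exact rotation. -/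
theorem norm_cayley_sub_exp {a : ℝ} {Y Z : ℂ} (h : (1 - a * I) * Z = (1 + a * I) * Y) :
    ‖Z - exp (2 * a * I) * Y‖ * √(1 + a ^ 2) = 2 * |Real.sin a - a * Real.cos a| * ‖Y‖ := by
  have hexp : exp (a * I) * exp (-(a * I)) = 1 := by rw [← exp_add]; simp
  have hexp2 : exp (2 * a * I) = exp (a * I) * exp (a * I) := by rw [← exp_add]; ring_nf
  have hp : exp (a * I) = Real.cos a + Real.sin a * I := by
    rw [exp_mul_I, ofReal_cos, ofReal_sin]
  have hm : exp (-(a * I)) = Real.cos a - Real.sin a * I := by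
    rw [← neg_mul, exp_mul_I, cos_neg, sin_neg, ofReal_cos, ofReal_sin]; ring
  have key : (Z - exp (2 * a * I) * Y) * (1 - a * I) =
      exp (a * I) * (-(2 * I)) * ((Real.sin a - a * Real.cos a : ℝ) : ℂ) * Y := by
    have h1 : (Z - exp (2 * a * I) * Y) * (1 - a * I) =
        exp (a * I) * (exp (-(a * I)) * (1 + a * I) - exp (a * I) * (1 - a * I)) * Y := by
      rw [hexp2]
      linear_combination h - (1 + a * I) * Y * hexp
    rw [h1, hm]
    nth_rewrite 2 [hp]
    push_cast
    ring
  have := congrArg norm key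
  rw [norm_mul, norm_one_sub_ofReal_mul_I] at this
  rw [this]
  simp only [norm_mul, norm_exp_ofReal_mul_I, norm_neg, norm_I, norm_real, Real.norm_eq_abs]
  simp

open Complex in
/-- Second divided difference of three consecutive Crank–Nicolson values. -/
theorem norm_second_divided_difference {ω σ ρ : ℝ} (hσ : 0 < σ) (hρ : 0 < ρ) {X Y Z : ℂ}
    (hXY : (Y - X) / ρ = ω * I * ((X + Y) / 2)) (hYZ : (Z - Y) / σ = ω * I * ((Y + Z) / 2)) :
    ‖((Z - Y) / σ - (Y - X) / ρ) / ((σ + ρ) / 2)‖ *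
      (√(1 + (ω * σ / 2) ^ 2) * √(1 + (ω * ρ / 2) ^ 2)) = ω ^ 2 * ‖Y‖ := by
  have hσ' : (σ : ℂ) ≠ 0 := by exact_mod_cast hσ.ne'
  have hρ' : (ρ : ℂ) ≠ 0 := by exact_mod_cast hρ.ne'
  have hs : (σ + ρ : ℂ) ≠ 0 := by exact_mod_cast (add_pos hσ hρ).ne'
  rw [← norm_one_sub_ofReal_mul_I, ← norm_one_add_ofReal_mul_I, ← norm_mul, ← norm_mul, hXY, hYZ]
  rw [div_eq_iff hρ'] at hXY
  rw [div_eq_iff hσ'] at hYZ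
  have key : (ω * I * ((Y + Z) / 2) - ω * I * ((X + Y) / 2)) / ((σ + ρ) / 2) *
      ((1 - (ω * σ / 2 : ℝ) * I) * (1 + (ω * ρ / 2 : ℝ) * I)) = -((ω ^ 2 : ℝ) * Y) := by
    rw [div_mul_eq_mul_div, div_eq_iff (by simpa using hs)]
    push_cast
    linear_combination (ω * I / 2) * ((1 + ω * ρ / 2 * I) * hYZ + (1 - ω * σ / 2 * I) * hXY)
      + (ω ^ 2 * (σ + ρ) / 2 * Y) * I_sq
  rw [key, norm_neg, norm_mul, norm_real, Real.norm_of_nonneg (sq_nonneg ω)]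

theorem le_indicator_of_mul_eq {ω σ ρ e η R : ℝ} (hω : 0 < ω) (hσ : 0 < σ) (hρ : 0 < ρ)
    (hR : 0 ≤ R)
    (he : e * √(1 + (ω * σ / 2) ^ 2) =
      2 * |Real.sin (ω * σ / 2) - ω * σ / 2 * Real.cos (ω * σ / 2)| * R)
    (hη : η * (√(1 + (ω * σ / 2) ^ 2) * √(1 + (ω * ρ / 2) ^ 2)) = ω ^ 2 * R) :
    e ≤ σ * (σ ^ 2 / 12 + ρ * σ / 8) * (ω * η) := by
  have ha : 0 < ω * σ / 2 := by positivity
  have hb : 0 < ω * ρ / 2 := by positivity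
  have hq : √(1 + (ω * ρ / 2) ^ 2) ≤ 1 + ω * ρ / 2 := by
    rw [Real.sqrt_le_left (by positivity)]; nlinarith
  have h3 := abs_sin_sub_mul_cos_le_cube ha.le
  have h2 := abs_sin_sub_mul_cos_le_sq ha.le
  set s := |Real.sin (ω * σ / 2) - ω * σ / 2 * Real.cos (ω * σ / 2)|
  have hs : 0 ≤ s := abs_nonneg _
  set p := √(1 + (ω * σ / 2) ^ 2)
  set q := √(1 + (ω * ρ / 2) ^ 2)
  have hp : 0 < p := by positivity
  have hq0 : 0 < q := by positivity
  refine le_of_mul_le_mul_right ?_ (mul_pos hp hq0)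
  calc e * (p * q) = 2 * s * R * q := by rw [← he]; ring
    _ ≤ 2 * s * R * (1 + ω * ρ / 2) := by gcongr
    _ = 2 * R * (s + s * (ω * ρ / 2)) := by ring
    _ ≤ 2 * R * ((ω * σ / 2) ^ 3 / 3 + (ω * σ / 2) ^ 2 / 2 * (ω * ρ / 2)) := by gcongr
    _ = σ * (σ ^ 2 / 12 + ρ * σ / 8) * ω * (ω ^ 2 * R) := by ring
    _ = σ * (σ ^ 2 / 12 + ρ * σ / 8) * (ω * η) * (p * q) := by rw [← hη]; ring

open Complex in
/-- Along a solution of `u'' + ω² u = 0`, the phase `u' + i ω u` rotates with speed `ω`. -/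
theorem phase_eq_exp_mul {ω T : ℝ} (hT : 0 < T) {u : ℝ → ℝ}
    (hu : ContDiffOn ℝ 2 u (Set.Icc 0 T))
    (hode : ∀ s ∈ Set.Icc (0 : ℝ) T, iteratedDerivWithin 2 u (Set.Icc 0 T) s + ω ^ 2 * u s = 0)
    {s : ℝ} (hs : s ∈ Set.Icc 0 T) :
    (derivWithin u (Set.Icc 0 T) s + ω * u s * I : ℂ) =
      exp (ω * s * I) * (derivWithin u (Set.Icc 0 T) 0 + ω * u 0 * I) := by
  have hU := uniqueDiffOn_Icc hT
  have hd1 : ∀ x ∈ Set.Icc 0 T, HasDerivWithinAt u (derivWithin u (Set.Icc 0 T) x)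
      (Set.Icc 0 T) x := fun x hx =>
    (hu.differentiableOn (by norm_num) x hx).hasDerivWithinAt
  have hd2 : ∀ x ∈ Set.Icc 0 T, HasDerivWithinAt (derivWithin u (Set.Icc 0 T))
      (-(ω ^ 2 * u x)) (Set.Icc 0 T) x := fun x hx => by
    have h := ((hu.derivWithin hU (m := 1) (by norm_num)).differentiableOn (by norm_num)
      x hx).hasDerivWithinAt
    have h' := hode x hx
    rw [iteratedDerivWithin_succ, iteratedDerivWithin_one] at h'
    rwa [eq_neg_of_add_eq_zero_left h'] at h
  have hd : ∀ x ∈ Set.Icc 0 T, HasDerivWithinAt (fun y : ℝ => exp (-(ω * y * I)) *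
      (derivWithin u (Set.Icc 0 T) y + ω * u y * I)) 0 (Set.Icc 0 T) x := fun x hx => by
    have he : HasDerivWithinAt (fun y : ℝ => exp (-(ω * y * I)))
        (exp (-(ω * x * I)) * (-(ω * 1 * I))) (Set.Icc 0 T) x :=
      ((((hasDerivAt_id x).ofReal_comp.const_mul (ω : ℂ)).mul_const I).neg.cexp).hasDerivWithinAt
    have hz := (hd2 x hx).ofReal_comp.add (((hd1 x hx).ofReal_comp.const_mul (ω : ℂ)).mul_const I)
    refine (he.mul hz).congr_deriv ?_
    rw [Pi.add_apply]
    push_cast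
    linear_combination -(exp (-(ω * x * I)) * ω ^ 2 * u x) * I_sq
  have hc := constant_of_derivWithin_zero (fun x hx => (hd x hx).differentiableWithinAt)
    (fun x hx => (hd x (Set.Ico_subset_Icc_self hx)).derivWithin
      (hU x (Set.Ico_subset_Icc_self hx))) s hs
  simp only [ofReal_zero, mul_zero, zero_mul, neg_zero, exp_zero, one_mul] at hc
  rw [← hc, ← mul_assoc, ← exp_add]
  simp

theorem norm_le_add_sum_Ico {E : ℕ → ℝ} {c : ℕ → ℝ} {c₀ : ℝ} (h0 : E 0 = 0) (hc₀ : 0 ≤ c₀)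
    {N : ℕ} (h1 : E 1 ≤ E 0 + c₀) (hE : ∀ k, 1 ≤ k → k < N → E (k + 1) ≤ E k + c k) :
    ∀ n ≤ N, E n ≤ c₀ + ∑ k ∈ Finset.Ico 1 n, c k := by
  intro n hn
  induction n with
  | zero => simpa [h0] using hc₀
  | succ n ih =>
    rcases Nat.eq_zero_or_pos n with rfl | hpos
    · simpa [h0] using h1
    · rw [Finset.sum_Ico_succ_top hpos]
      linarith [ih (by lia), hE n hpos (by lia)]

/-- the 3-point a posteriori error estimate (Theorem 3.1) specialized to
the homogeneous scalar ODE `u'' + A u = 0` with exact initial data: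
`max_{0≤n≤N} (|v^n − u'(t_n)|² + A|u^n − u(t_n)|²)^{1/2}` is bounded by twice the sum of
the 3-point time error indicators. -/
theorem aposteriori_error_estimate_ode_homogeneous
    (A : ℝ) (hA : 0 < A) (T : ℝ) (hT : 0 < T)
    (u : ℝ → ℝ) (hu : ContDiffOn ℝ 2 u (Set.Icc 0 T))
    (hode : ∀ s ∈ Set.Icc (0 : ℝ) T,
        iteratedDerivWithin 2 u (Set.Icc 0 T) s + A * u s = 0)
    (N : ℕ) (hN : 2 ≤ N)
    (τ : ℕ → ℝ) (hτ : ∀ n, 0 < τ n)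
    (t : ℕ → ℝ) (ht0 : t 0 = 0) (htrec : ∀ n, t (n + 1) = t n + τ n) (htN : t N = T)
    (U W : ℕ → ℝ)
    (hCN1 : ∀ n, (U (n + 1) - U n) / τ n = (W n + W (n + 1)) / 2)
    (hCN2 : ∀ n, (W (n + 1) - W n) / τ n + A * (U (n + 1) + U n) / 2 = 0)
    (hU0 : U 0 = u 0) (hW0 : W 0 = derivWithin u (Set.Icc 0 T) 0) :
    ∀ n ≤ N,
      Real.sqrt (|W n - derivWithin u (Set.Icc 0 T) (t n)| ^ 2
          + A * |U n - u (t n)| ^ 2)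
        ≤ 2 * (τ 0 * ((5 / 12) * τ 0 ^ 2 + (1 / 2) * τ 1 * τ 0)
              * Real.sqrt (A * (secondDiff τ W 1) ^ 2 + A ^ 2 * (secondDiff τ U 1) ^ 2)
            + ∑ k ∈ Finset.Icc 1 (N - 1),
                τ k * (τ k ^ 2 / 12 + τ (k - 1) * τ k / 8)
                  * Real.sqrt (A * (secondDiff τ W k) ^ 2
                      + A ^ 2 * (secondDiff τ U k) ^ 2)) := by
  obtain ⟨ω, hω, rfl⟩ : ∃ ω : ℝ, 0 < ω ∧ ω ^ 2 = A :=
    ⟨√A, Real.sqrt_pos.2 hA, Real.sq_sqrt hA.le⟩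
  set Z : ℕ → ℂ := fun n => W n + ω * U n * Complex.I with hZ
  set z : ℝ → ℂ := fun s => derivWithin u (Set.Icc 0 T) s + ω * u s * Complex.I with hz
  set D : ℕ → ℂ := fun k =>
    ((Z (k + 1) - Z k) / τ k - (Z k - Z (k - 1)) / τ (k - 1)) / ((τ k + τ (k - 1)) / 2) with hD
  have hnorm : ∀ x y : ℝ, ‖(x + ω * y * Complex.I : ℂ)‖ = √(x ^ 2 + ω ^ 2 * y ^ 2) := by
    intro x y
    rw [← mul_pow, ← Complex.norm_add_mul_I]
    push_cast
    rfl
  have hstep : ∀ n, (Z (n + 1) - Z n) / τ n = ω * Complex.I * ((Z n + Z (n + 1)) / 2) := by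
    intro n
    have h1 : ((U (n + 1) - U n) / τ n : ℂ) = (W n + W (n + 1)) / 2 := by exact_mod_cast hCN1 n
    have h2 : ((W (n + 1) - W n) / τ n + ω ^ 2 * (U (n + 1) + U n) / 2 : ℂ) = 0 := by
      exact_mod_cast hCN2 n
    simp only [hZ]
    linear_combination h2 + ω * Complex.I * h1
      - (ω ^ 2 * (U n + U (n + 1)) / 2 : ℂ) * Complex.I_sq
  have hcayley : ∀ n, (1 - (ω * τ n / 2 : ℝ) * Complex.I) * Z (n + 1) =
      (1 + (ω * τ n / 2 : ℝ) * Complex.I) * Z n := by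
    intro n
    have hτn : (τ n : ℂ) ≠ 0 := by exact_mod_cast (hτ n).ne'
    have h := hstep n
    rw [div_eq_iff hτn] at h
    push_cast
    linear_combination h
  have hconst : ∀ n, ‖Z n‖ = ‖Z 0‖ := by
    intro n
    induction n with
    | zero => rfl
    | succ n ih => rw [norm_eq_of_cayley (hcayley n), ih]
  have hDnorm : ∀ k, √(ω ^ 2 * secondDiff τ W k ^ 2 + (ω ^ 2) ^ 2 * secondDiff τ U k ^ 2) =
      ω * ‖D k‖ := by
    intro k
    have h : D k = secondDiff τ W k + ω * secondDiff τ U k * Complex.I := by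
      simp only [hD, hZ, secondDiff]
      push_cast
      ring
    rw [h, hnorm, ← Real.sqrt_sq hω.le, ← Real.sqrt_mul (sq_nonneg _), Real.sqrt_sq hω.le]
    congr 1
    ring
  have hDval : ∀ k, ‖D (k + 1)‖ *
      (√(1 + (ω * τ (k + 1) / 2) ^ 2) * √(1 + (ω * τ k / 2) ^ 2)) = ω ^ 2 * ‖Z 0‖ := by
    intro k
    rw [← hconst (k + 1)]
    exact norm_second_divided_difference (hτ (k + 1)) (hτ k) (hstep k) (hstep (k + 1))
  have hmono : Monotone t := monotone_nat_of_le_succ fun n => by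
    rw [htrec]; linarith [hτ n]
  have hmem : ∀ n ≤ N, t n ∈ Set.Icc 0 T := fun n hn =>
    ⟨ht0 ▸ hmono (Nat.zero_le n), htN ▸ hmono hn⟩
  have hexact : ∀ n < N, z (t (n + 1)) = Complex.exp (2 * (ω * τ n / 2 : ℝ) * Complex.I) *
      z (t n) := by
    intro n hn
    simp only [hz]
    rw [phase_eq_exp_mul hT hu hode (hmem (n + 1) hn),
      phase_eq_exp_mul hT hu hode (hmem n hn.le), ← mul_assoc, ← Complex.exp_add, htrec]
    congr 2
    push_cast
    ring
  have hlocal := fun n => norm_cayley_sub_exp (hcayley n)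
  have herr : ∀ n < N, ‖Z (n + 1) - z (t (n + 1))‖ ≤ ‖Z n - z (t n)‖ +
      ‖Z (n + 1) - Complex.exp (2 * (ω * τ n / 2 : ℝ) * Complex.I) * Z n‖ := by
    intro n hn
    have hrot : ‖Complex.exp (2 * (ω * τ n / 2 : ℝ) * Complex.I)‖ = 1 := by
      exact_mod_cast Complex.norm_exp_ofReal_mul_I (2 * (ω * τ n / 2))
    calc _ = ‖Complex.exp (2 * (ω * τ n / 2 : ℝ) * Complex.I) * (Z n - z (t n)) +
          (Z (n + 1) - Complex.exp (2 * (ω * τ n / 2 : ℝ) * Complex.I) * Z n)‖ := by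
            rw [hexact n hn]; congr 1; ring
      _ ≤ _ := norm_add_le _ _
      _ = _ := by rw [norm_mul, hrot, one_mul]
  simp_rw [hDnorm]
  have hτ0 := hτ 0
  have hτ1 := hτ 1
  have hfirst : ‖Z 1 - z (t 1)‖ ≤ ‖Z 0 - z (t 0)‖ +
      τ 0 * (5 / 12 * τ 0 ^ 2 + 1 / 2 * τ 1 * τ 0) * (ω * ‖D 1‖) := by
    have h := le_indicator_of_mul_eq hω hτ0 hτ1 (norm_nonneg _) (hlocal 0)
      ((congrArg _ (mul_comm _ _)).trans (hDval 0))
    refine (herr 0 (by lia)).trans (add_le_add_right (h.trans ?_) _)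
    have := mul_pos hτ0 hτ1
    have : τ 0 ^ 2 / 12 + τ 1 * τ 0 / 8 ≤ 5 / 12 * τ 0 ^ 2 + 1 / 2 * τ 1 * τ 0 := by
      linarith [sq_nonneg (τ 0)]
    gcongr ?_ * ?_ * ?_
  have hnext : ∀ k, 1 ≤ k → k < N → ‖Z (k + 1) - z (t (k + 1))‖ ≤ ‖Z k - z (t k)‖ +
      τ k * (τ k ^ 2 / 12 + τ (k - 1) * τ k / 8) * (ω * ‖D k‖) := by
    intro k hk hkN
    obtain ⟨j, rfl⟩ := Nat.exists_eq_add_of_le' hk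
    have h := le_indicator_of_mul_eq hω (hτ (j + 1)) (hτ j) (norm_nonneg _) (hlocal (j + 1))
      ((hDval j).trans (by rw [hconst (j + 1)]))
    exact (herr _ hkN).trans (add_le_add_right h _)
  have hinit : ‖Z 0 - z (t 0)‖ = 0 := by simp [hZ, hz, ht0, hU0, hW0]
  intro n hn
  have hc : ∀ k, 0 ≤ τ k * (τ k ^ 2 / 12 + τ (k - 1) * τ k / 8) * (ω * ‖D k‖) := fun k => by
    have := hτ k
    have := hτ (k - 1)
    positivity
  have hbound := norm_le_add_sum_Ico (E := fun n => ‖Z n - z (t n)‖) hinit (by positivity)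
    hfirst hnext n hn
  have hsum := Finset.sum_le_sum_of_subset_of_nonneg
    (s := Finset.Ico 1 n) (t := Finset.Icc 1 (N - 1))
    (fun k hk => by simp only [Finset.mem_Ico, Finset.mem_Icc] at *; lia) (fun k _ _ => hc k)
  have hlhs : √(|W n - derivWithin u (Set.Icc 0 T) (t n)| ^ 2 + ω ^ 2 * |U n - u (t n)| ^ 2) =
      ‖Z n - z (t n)‖ := by
    rw [sq_abs, sq_abs, ← hnorm]
    congr 1
    simp only [hZ, hz]
    push_cast
    ring
  rw [hlhs]
  linarith [hbound.trans (add_le_add_right hsum _), norm_nonneg (Z n - z (t n))]
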